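/- arXiv:2308.10002 — 4 statements merged into one kernel-verified Lean document; each statement's English description precedes it below -/
import Mathlib

section
/- For every real number β, the functional J_β(u) = (1/2)∫_V |∇u|² dμ − β log ∫_V h e^u dμ attains its infimum over H at some u ∈ H, and this minimizer u satisfies the Kazdan–Warner equation Δu = −β h e^u / (∫_V h e^u dμ) + β / Vol(V) on V. -/
open Finset

variable {V : Type*}

/-- Integral of `g` over `V` with respect to the measure `μ`. -/
noncomputable def intV [Fintype V] (μ g : V → ℝ) : ℝ := ∑ x, μ x * g x

/-- Volume of `V` with respect to the measure `μ`. -/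
noncomputable def volV [Fintype V] (μ : V → ℝ) : ℝ := ∑ x, μ x

/-- The space `H` of functions with zero mean. -/
def Hsp [Fintype V] (μ : V → ℝ) : Set (V → ℝ) := {u | intV μ u = 0}

/-- `|∇u|²(x)`, the squared length of the gradient of `u` at `x`. -/
noncomputable def gradSq [Fintype V] (G : SimpleGraph V) [DecidableRel G.Adj]
    (w : V → V → ℝ) (μ : V → ℝ) (u : V → ℝ) (x : V) : ℝ :=
  (1 / (2 * μ x)) * ∑ y, if G.Adj x y then w x y * (u y - u x) ^ 2 else 0

/-- The `μ`-Laplacian `Δu(x)`. -/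
noncomputable def lapV [Fintype V] (G : SimpleGraph V) [DecidableRel G.Adj]
    (w : V → V → ℝ) (μ : V → ℝ) (u : V → ℝ) (x : V) : ℝ :=
  (1 / μ x) * ∑ y, if G.Adj x y then w x y * (u y - u x) else 0

/-- The functional `J_β`. -/
noncomputable def Jb [Fintype V] (G : SimpleGraph V) [DecidableRel G.Adj]
    (w : V → V → ℝ) (μ h : V → ℝ) (β : ℝ) (u : V → ℝ) : ℝ :=
  (1 / 2) * intV μ (gradSq G w μ u)
    - β * Real.log (intV μ (fun x => h x * Real.exp (u x)))

/-- The functional `J_{α,β}`. -/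
noncomputable def Jab [Fintype V] (G : SimpleGraph V) [DecidableRel G.Adj]
    (w : V → V → ℝ) (μ h : V → ℝ) (α β : ℝ) (u : V → ℝ) : ℝ :=
  (1 / 2) * intV μ (fun x => gradSq G w μ u x - α * u x ^ 2)
    - β * Real.log (intV μ (fun x => h x * Real.exp (u x)))

/-- The first non-zero eigenvalue `λ₁(V)` of `-Δ`, defined variationally. -/
noncomputable def lam1V [Fintype V] (G : SimpleGraph V) [DecidableRel G.Adj]
    (w : V → V → ℝ) (μ : V → ℝ) : ℝ :=
  sInf ((fun u => intV μ (gradSq G w μ u)) ''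
    {u | u ∈ Hsp μ ∧ intV μ (fun x => u x ^ 2) = 1})

/-- The eigenspace of `-Δ` with eigenvalue `c` (inside `H`). -/
def eigSp [Fintype V] (G : SimpleGraph V) [DecidableRel G.Adj]
    (w : V → V → ℝ) (μ : V → ℝ) (c : ℝ) : Set (V → ℝ) :=
  {v | intV μ v = 0 ∧ ∀ x, -(lapV G w μ v x) = c * v x}

/-- `E_k^⊥`: functions in `H` orthogonal to the eigenspaces of the first `k`
distinct non-zero eigenvalues (`lam` lists the distinct non-zero eigenvalues,
0-indexed, so `lam ⟨s⟩` is `λ_{s+1}(V)`). -/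
def EkPerp [Fintype V] (G : SimpleGraph V) [DecidableRel G.Adj]
    (w : V → V → ℝ) (μ : V → ℝ) {m : ℕ} (lam : Fin m → ℝ) (k : ℕ) : Set (V → ℝ) :=
  {u | u ∈ Hsp μ ∧ ∀ s : Fin m, (s : ℕ) < k → ∀ v ∈ eigSp G w μ (lam s),
    intV μ (fun x => u x * v x) = 0}

/-- The Dirichlet form `∫ Γ(u, v) dμ` as a sum over ordered pairs of adjacent vertices. -/
noncomputable def dirichletForm [Fintype V] (G : SimpleGraph V) [DecidableRel G.Adj]
    (w : V → V → ℝ) (u v : V → ℝ) : ℝ :=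
  (1 / 2) * ∑ x, ∑ y, if G.Adj x y then w x y * ((u y - u x) * (v y - v x)) else 0

theorem intV_gradSq [Fintype V] (G : SimpleGraph V) [DecidableRel G.Adj]
    (w : V → V → ℝ) {μ : V → ℝ} (hμ : ∀ x, 0 < μ x) (u : V → ℝ) :
    intV μ (gradSq G w μ u) = dirichletForm G w u u := by
  unfold intV gradSq dirichletForm
  rw [Finset.mul_sum]
  refine Finset.sum_congr rfl fun x _ => ?_
  have := (hμ x).ne'
  rw [← mul_assoc, show μ x * (1 / (2 * μ x)) = 1 / 2 by field_simp]
  simp only [pow_two]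

theorem dirichletForm_add_smul [Fintype V] (G : SimpleGraph V) [DecidableRel G.Adj]
    (w : V → V → ℝ) (u v : V → ℝ) (t : ℝ) :
    dirichletForm G w (u + t • v) (u + t • v) = dirichletForm G w u u
      + 2 * dirichletForm G w u v * t + dirichletForm G w v v * t ^ 2 := by
  unfold dirichletForm
  simp only [Finset.mul_sum, Finset.sum_mul, ← Finset.sum_add_distrib]
  refine Finset.sum_congr rfl fun x _ => Finset.sum_congr rfl fun y _ => ?_
  split_ifs
  · simp only [Pi.add_apply, Pi.smul_apply, smul_eq_mul]
    ring
  · simp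

theorem dirichletForm_smul_self [Fintype V] (G : SimpleGraph V) [DecidableRel G.Adj]
    (w : V → V → ℝ) (v : V → ℝ) (t : ℝ) :
    dirichletForm G w (t • v) (t • v) = t ^ 2 * dirichletForm G w v v := by
  have := dirichletForm_add_smul G w 0 v t
  simpa [dirichletForm, mul_comm] using this

/-- Green's formula. -/
theorem intV_lapV_mul [Fintype V] (G : SimpleGraph V) [DecidableRel G.Adj]
    {w : V → V → ℝ} (hws : ∀ x y, w x y = w y x) {μ : V → ℝ} (hμ : ∀ x, 0 < μ x)
    (u v : V → ℝ) :
    intV μ (fun x => lapV G w μ u x * v x) = -dirichletForm G w u v := by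
  have h₁ : intV μ (fun x => lapV G w μ u x * v x)
      = ∑ x, ∑ y, if G.Adj x y then w x y * ((u y - u x) * v x) else 0 := by
    unfold intV lapV
    refine Finset.sum_congr rfl fun x _ => ?_
    have := (hμ x).ne'
    rw [← mul_assoc, ← mul_assoc, mul_one_div_cancel this, one_mul, Finset.sum_mul]
    refine Finset.sum_congr rfl fun y _ => ?_
    split_ifs
    · ring
    · simp
  have h₂ : intV μ (fun x => lapV G w μ u x * v x)
      = ∑ x, ∑ y, if G.Adj x y then w x y * ((u x - u y) * v y) else 0 := by
    rw [h₁, Finset.sum_comm]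
    refine Finset.sum_congr rfl fun x _ => Finset.sum_congr rfl fun y _ => ?_
    simp only [G.adj_comm y x, hws y x]
  have h₃ : 2 * dirichletForm G w u v = -(intV μ (fun x => lapV G w μ u x * v x)
      + intV μ (fun x => lapV G w μ u x * v x)) := by
    nth_rewrite 1 [h₁]
    rw [h₂]
    unfold dirichletForm
    rw [← mul_assoc, mul_one_div_cancel two_ne_zero, one_mul, ← Finset.sum_add_distrib,
      ← Finset.sum_neg_distrib]
    refine Finset.sum_congr rfl fun x _ => ?_
    rw [← Finset.sum_add_distrib, ← Finset.sum_neg_distrib]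
    refine Finset.sum_congr rfl fun y _ => ?_
    split_ifs
    · ring
    · simp
  linarith

theorem intV_lapV [Fintype V] (G : SimpleGraph V) [DecidableRel G.Adj]
    {w : V → V → ℝ} (hws : ∀ x y, w x y = w y x) {μ : V → ℝ} (hμ : ∀ x, 0 < μ x)
    (u : V → ℝ) : intV μ (lapV G w μ u) = 0 := by
  simpa [dirichletForm] using intV_lapV_mul G hws hμ u 1

theorem dirichletForm_self_nonneg [Fintype V] (G : SimpleGraph V) [DecidableRel G.Adj]
    {w : V → V → ℝ} (hwp : ∀ x y, G.Adj x y → 0 < w x y) (u : V → ℝ) :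
    0 ≤ dirichletForm G w u u := by
  unfold dirichletForm
  refine mul_nonneg (by norm_num) (Finset.sum_nonneg fun x _ => Finset.sum_nonneg fun y _ => ?_)
  split_ifs with hxy
  · exact mul_nonneg (hwp x y hxy).le (mul_self_nonneg _)
  · exact le_rfl

theorem eq_of_dirichletForm_self_eq_zero [Fintype V] (G : SimpleGraph V) [DecidableRel G.Adj]
    (hG : G.Connected) {w : V → V → ℝ} (hwp : ∀ x y, G.Adj x y → 0 < w x y) {u : V → ℝ}
    (hu : dirichletForm G w u u = 0) (x y : V) : u x = u y := by
  have hterm : ∀ x y, 0 ≤ if G.Adj x y then w x y * ((u y - u x) * (u y - u x)) else 0 := by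
    intro x y
    split_ifs with hxy
    · exact mul_nonneg (hwp x y hxy).le (mul_self_nonneg _)
    · exact le_rfl
  have hsum : ∑ x, ∑ y, (if G.Adj x y then w x y * ((u y - u x) * (u y - u x)) else 0) = 0 := by
    unfold dirichletForm at hu
    linarith
  have hadj : ∀ x y, G.Adj x y → u x = u y := by
    intro x y hxy
    have h₁ := (Finset.sum_eq_zero_iff_of_nonneg
      (fun x _ => Finset.sum_nonneg fun y _ => hterm x y)).1 hsum x (Finset.mem_univ x)
    have h₂ := (Finset.sum_eq_zero_iff_of_nonneg
      (fun y _ => hterm x y)).1 h₁ y (Finset.mem_univ y)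
    rw [if_pos hxy] at h₂
    have h₃ := mul_self_eq_zero.1 ((mul_eq_zero.1 h₂).resolve_left (hwp x y hxy).ne')
    linarith
  obtain ⟨p⟩ := hG.preconnected x y
  induction p with
  | nil => rfl
  | cons hxy _ ih => exact (hadj _ _ hxy).trans ih

theorem volV_pos [Fintype V] [Nonempty V] {μ : V → ℝ} (hμ : ∀ x, 0 < μ x) : 0 < volV μ :=
  Finset.sum_pos (fun x _ => hμ x) Finset.univ_nonempty

theorem continuous_intV [Fintype V] (μ : V → ℝ) : Continuous (intV μ) := by
  unfold intV
  fun_prop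

theorem isClosed_Hsp [Fintype V] (μ : V → ℝ) : IsClosed (Hsp μ) :=
  isClosed_eq (continuous_intV μ) continuous_const

theorem intV_add_smul [Fintype V] (μ u v : V → ℝ) (t : ℝ) :
    intV μ (u + t • v) = intV μ u + t * intV μ v := by
  simp only [intV, Finset.mul_sum, ← Finset.sum_add_distrib, Pi.add_apply, Pi.smul_apply,
    smul_eq_mul]
  exact Finset.sum_congr rfl fun x _ => by ring

theorem add_smul_mem_Hsp [Fintype V] {μ u v : V → ℝ} (hu : u ∈ Hsp μ) (hv : v ∈ Hsp μ) (t : ℝ) :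
    u + t • v ∈ Hsp μ := by
  have hu : intV μ u = 0 := hu
  have hv : intV μ v = 0 := hv
  simp [Hsp, intV_add_smul, hu, hv]

theorem continuous_dirichletForm_self [Fintype V] (G : SimpleGraph V) [DecidableRel G.Adj]
    (w : V → V → ℝ) : Continuous fun u : V → ℝ => dirichletForm G w u u := by
  unfold dirichletForm
  refine continuous_const.mul
    (continuous_finsetSum _ fun x _ => continuous_finsetSum _ fun y _ => ?_)
  split_ifs <;> fun_prop

/-- The Poincaré inequality on mean-zero functions. -/
theorem exists_mul_norm_sq_le_dirichletForm [Fintype V] (G : SimpleGraph V) [DecidableRel G.Adj]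
    (hG : G.Connected) {w : V → V → ℝ} (hwp : ∀ x y, G.Adj x y → 0 < w x y)
    {μ : V → ℝ} (hμ : ∀ x, 0 < μ x) :
    ∃ c > 0, ∀ v ∈ Hsp μ, c * ‖v‖ ^ 2 ≤ dirichletForm G w v v := by
  have hcomp : IsCompact (Metric.sphere (0 : V → ℝ) 1 ∩ Hsp μ) :=
    (isCompact_sphere 0 1).inter_right (isClosed_Hsp μ)
  have hpos : ∀ v ∈ Metric.sphere (0 : V → ℝ) 1 ∩ Hsp μ, 0 < dirichletForm G w v v := by
    rintro v ⟨hv, hvH⟩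
    refine (dirichletForm_self_nonneg G hwp v).lt_of_ne' fun h0 => ?_
    have : Nonempty V := hG.nonempty
    have hconst := eq_of_dirichletForm_self_eq_zero G hG hwp h0
    have hv0 : v = 0 := by
      funext x
      have hx : intV μ v = volV μ * v x := by
        unfold intV volV
        rw [Finset.sum_mul]
        exact Finset.sum_congr rfl fun y _ => by rw [hconst y x]
      have hvH : intV μ v = 0 := hvH
      exact (mul_eq_zero.1 (hx.symm.trans hvH)).resolve_left (volV_pos hμ).ne'
    simp [hv0] at hv
  obtain ⟨c, hc, hcle⟩ :=
    hcomp.exists_forall_le' (continuous_dirichletForm_self G w).continuousOn hpos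
  refine ⟨c, hc, fun v hv => ?_⟩
  by_cases hv0 : v = 0
  · simp [hv0, dirichletForm]
  have hn : 0 < ‖v‖ := norm_pos_iff.2 hv0
  have hmem : ‖v‖⁻¹ • v ∈ Metric.sphere (0 : V → ℝ) 1 ∩ Hsp μ := by
    refine ⟨by simp [norm_smul, hn.ne'], ?_⟩
    simpa using add_smul_mem_Hsp (u := 0) (by simp [Hsp, intV]) hv ‖v‖⁻¹
  have h := hcle _ hmem
  rw [dirichletForm_smul_self, inv_pow, ← div_eq_inv_mul, le_div_iff₀ (by positivity)] at h
  exact h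

theorem intV_mul_exp_pos [Fintype V] [Nonempty V] {μ h : V → ℝ} (hμ : ∀ x, 0 < μ x)
    (hh : ∀ x, 0 < h x) (u : V → ℝ) : 0 < intV μ (fun x => h x * Real.exp (u x)) :=
  Finset.sum_pos (fun x _ => mul_pos (hμ x) (mul_pos (hh x) (Real.exp_pos _)))
    Finset.univ_nonempty

theorem abs_log_intV_mul_exp_le [Fintype V] [Nonempty V] {μ h : V → ℝ} (hμ : ∀ x, 0 < μ x)
    (hh : ∀ x, 0 < h x) (u : V → ℝ) :
    |Real.log (intV μ (fun x => h x * Real.exp (u x)))| ≤ ‖u‖ + |Real.log (intV μ h)| := by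
  have hI := intV_mul_exp_pos hμ hh u
  have hM : 0 < intV μ h :=
    Finset.sum_pos (fun x _ => mul_pos (hμ x) (hh x)) Finset.univ_nonempty
  have hux : ∀ x, |u x| ≤ ‖u‖ := fun x => norm_le_pi_norm u x
  have hupper : intV μ (fun x => h x * Real.exp (u x)) ≤ intV μ h * Real.exp ‖u‖ := by
    unfold intV
    rw [Finset.sum_mul]
    refine Finset.sum_le_sum fun x _ => ?_
    rw [← mul_assoc]
    exact mul_le_mul_of_nonneg_left (Real.exp_le_exp.2 (abs_le.1 (hux x)).2)
      (mul_pos (hμ x) (hh x)).le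
  have hlower : intV μ h * Real.exp (-‖u‖) ≤ intV μ (fun x => h x * Real.exp (u x)) := by
    unfold intV
    rw [Finset.sum_mul]
    refine Finset.sum_le_sum fun x _ => ?_
    rw [← mul_assoc]
    exact mul_le_mul_of_nonneg_left (Real.exp_le_exp.2 (abs_le.1 (hux x)).1)
      (mul_pos (hμ x) (hh x)).le
  have h₁ := Real.log_le_log hI hupper
  have h₂ := Real.log_le_log (mul_pos hM (Real.exp_pos _)) hlower
  rw [Real.log_mul hM.ne' (Real.exp_pos _).ne', Real.log_exp] at h₁ h₂
  have h₃ := abs_le.1 (le_refl |Real.log (intV μ h)|)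
  exact abs_le.2 ⟨by linarith, by linarith⟩

theorem continuous_Jb [Fintype V] [Nonempty V] (G : SimpleGraph V) [DecidableRel G.Adj]
    (w : V → V → ℝ) {μ h : V → ℝ} (hμ : ∀ x, 0 < μ x) (hh : ∀ x, 0 < h x) (β : ℝ) :
    Continuous (Jb G w μ h β) := by
  unfold Jb
  simp only [intV_gradSq G w hμ]
  refine (continuous_const.mul (continuous_dirichletForm_self G w)).sub
    (continuous_const.mul (Continuous.log ?_ fun u => (intV_mul_exp_pos hμ hh u).ne'))
  exact (continuous_intV μ).comp (by fun_prop)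

theorem exists_isMinOn_Jb [Fintype V] (G : SimpleGraph V) [DecidableRel G.Adj]
    (hG : G.Connected) {w : V → V → ℝ} (hwp : ∀ x y, G.Adj x y → 0 < w x y)
    {μ h : V → ℝ} (hμ : ∀ x, 0 < μ x) (hh : ∀ x, 0 < h x) (β : ℝ) :
    ∃ u ∈ Hsp μ, IsMinOn (Jb G w μ h β) (Hsp μ) u := by
  have : Nonempty V := hG.nonempty
  obtain ⟨c, hc, hP⟩ := exists_mul_norm_sq_le_dirichletForm G hG hwp hμ
  have hbound : ∀ v ∈ Hsp μ,
      ‖v‖ * (c / 2 * ‖v‖ - |β|) - |β| * |Real.log (intV μ h)| ≤ Jb G w μ h β v := by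
    intro v hv
    have h₁ := hP v hv
    have h₂ := mul_le_mul_of_nonneg_left (abs_log_intV_mul_exp_le hμ hh v) (abs_nonneg β)
    rw [← abs_mul] at h₂
    have h₃ := (le_abs_self _).trans h₂
    unfold Jb
    rw [intV_gradSq G w hμ]
    nlinarith
  have htend : Filter.Tendsto
      (fun v : V → ℝ => ‖v‖ * (c / 2 * ‖v‖ - |β|) - |β| * |Real.log (intV μ h)|)
      (Filter.cocompact _) Filter.atTop := by
    have hn := tendsto_norm_cocompact_atTop (E := V → ℝ)
    refine Filter.tendsto_atTop_add_const_right _ _ (hn.atTop_mul_atTop₀ ?_)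
    exact Filter.tendsto_atTop_add_const_right _ _ (hn.const_mul_atTop (by positivity))
  refine (continuous_Jb G w hμ hh β).continuousOn.exists_isMinOn' (isClosed_Hsp μ)
    (x₀ := 0) (by simp [Hsp, intV]) ?_
  rw [Filter.eventually_inf_principal]
  filter_upwards [htend.eventually_ge_atTop (Jb G w μ h β 0)] with v hv hvH
  exact hv.trans (hbound v hvH)

theorem hasDerivAt_Jb_add_smul [Fintype V] [Nonempty V] (G : SimpleGraph V) [DecidableRel G.Adj]
    {w : V → V → ℝ} (hws : ∀ x y, w x y = w y x) {μ h : V → ℝ} (hμ : ∀ x, 0 < μ x)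
    (hh : ∀ x, 0 < h x) (β : ℝ) (u v : V → ℝ) :
    HasDerivAt (fun t : ℝ => Jb G w μ h β (u + t • v))
      (-intV μ (fun x => (lapV G w μ u x + β * h x * Real.exp (u x) /
        intV μ (fun y => h y * Real.exp (u y))) * v x)) 0 := by
  have hI := intV_mul_exp_pos hμ hh u
  have hexp : HasDerivAt
      (fun t : ℝ => intV μ (fun x => h x * Real.exp ((u + t • v) x)))
      (intV μ (fun x => h x * (Real.exp (u x) * v x))) 0 := by
    unfold intV
    refine HasDerivAt.fun_sum fun x _ => ((HasDerivAt.const_mul _ ?_).const_mul _)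
    have hlin : HasDerivAt (fun t : ℝ => (u + t • v) x) (v x) 0 := by
      simpa using ((hasDerivAt_id (0 : ℝ)).mul_const (v x)).const_add (u x)
    simpa using hlin.exp
  have hlog := (hexp.log (by simpa using hI.ne')).const_mul β
  have hquad : HasDerivAt (fun t : ℝ => (1 / 2) * (dirichletForm G w u u
      + 2 * dirichletForm G w u v * t + dirichletForm G w v v * t ^ 2))
      (dirichletForm G w u v) 0 := by
    have h₁ := ((hasDerivAt_id (0 : ℝ)).const_mul (2 * dirichletForm G w u v)).const_add
      (dirichletForm G w u u)
    have h₂ := ((hasDerivAt_id (0 : ℝ)).pow 2).const_mul (dirichletForm G w v v)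
    refine ((h₁.add h₂).const_mul (1 / 2)).congr_deriv ?_
    simp
  unfold Jb
  simp only [intV_gradSq G w hμ, dirichletForm_add_smul]
  refine (hquad.sub hlog).congr_deriv ?_
  have hsplit : intV μ (fun x => (lapV G w μ u x + β * h x * Real.exp (u x) /
        intV μ (fun y => h y * Real.exp (u y))) * v x)
      = intV μ (fun x => lapV G w μ u x * v x)
        + β * (intV μ (fun x => h x * (Real.exp (u x) * v x)) /
          intV μ (fun y => h y * Real.exp (u y))) := by
    generalize intV μ (fun y => h y * Real.exp (u y)) = I
    unfold intV
    rw [Finset.sum_div, Finset.mul_sum, ← Finset.sum_add_distrib]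
    exact Finset.sum_congr rfl fun x _ => by ring
  rw [hsplit, intV_lapV_mul G hws hμ]
  simp only [zero_smul, add_zero]
  ring

/-- A function orthogonal to all mean-zero functions is equal to its mean. -/
theorem eq_intV_div_volV_of_orthogonal_Hsp [Fintype V] [Nonempty V] {μ : V → ℝ}
    (hμ : ∀ x, 0 < μ x) {f : V → ℝ}
    (hf : ∀ v ∈ Hsp μ, intV μ (fun x => f x * v x) = 0) (x : V) :
    f x = intV μ f / volV μ := by
  set m := intV μ f / volV μ with hm
  have hmean : intV μ (fun x => f x - m) = 0 := by
    have h₁ : intV μ (fun x => f x - m) = intV μ f - volV μ * m := by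
      unfold intV volV
      rw [Finset.sum_mul, ← Finset.sum_sub_distrib]
      exact Finset.sum_congr rfl fun x _ => by ring
    rw [h₁, hm, mul_div_cancel₀ _ (volV_pos hμ).ne', sub_self]
  have hsq : ∑ x, μ x * (f x - m) ^ 2 = 0 := by
    have h₂ : ∑ x, μ x * (f x - m) ^ 2
        = intV μ (fun x => f x * (f x - m)) - m * intV μ (fun x => f x - m) := by
      unfold intV
      rw [Finset.mul_sum, ← Finset.sum_sub_distrib]
      exact Finset.sum_congr rfl fun x _ => by ring
    rw [h₂, hf _ hmean, hmean, mul_zero, sub_zero]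
  have hx := (Finset.sum_eq_zero_iff_of_nonneg
    (fun y _ => mul_nonneg (hμ y).le (sq_nonneg (f y - m)))).1 hsq x (Finset.mem_univ x)
  exact sub_eq_zero.1 (pow_eq_zero_iff two_ne_zero |>.1
    ((mul_eq_zero.1 hx).resolve_left (hμ x).ne'))

theorem stmt0 [Fintype V] (G : SimpleGraph V) [DecidableRel G.Adj]
    (hG : G.Connected) (w : V → V → ℝ) (hws : ∀ x y, w x y = w y x)
    (hwp : ∀ x y, G.Adj x y → 0 < w x y)
    (μ : V → ℝ) (hμ : ∀ x, 0 < μ x) (h : V → ℝ) (hh : ∀ x, 0 < h x) (β : ℝ) :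
    ∃ u ∈ Hsp μ, (∀ v ∈ Hsp μ, Jb G w μ h β u ≤ Jb G w μ h β v) ∧
      ∀ x, lapV G w μ u x =
        -(β * h x * Real.exp (u x)) / intV μ (fun y => h y * Real.exp (u y))
          + β / volV μ := by
  have : Nonempty V := hG.nonempty
  obtain ⟨u, hu, hmin⟩ := exists_isMinOn_Jb G hG hwp hμ hh β
  refine ⟨u, hu, fun v hv => hmin hv, fun x => ?_⟩
  have hI := intV_mul_exp_pos hμ hh u
  have horth : ∀ v ∈ Hsp μ, intV μ (fun x => (lapV G w μ u x + β * h x * Real.exp (u x) /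
      intV μ (fun y => h y * Real.exp (u y))) * v x) = 0 := by
    intro v hv
    have hloc : IsLocalMin (fun t : ℝ => Jb G w μ h β (u + t • v)) 0 :=
      Filter.Eventually.of_forall fun t => by
        simpa using hmin (add_smul_mem_Hsp hu hv t)
    exact neg_eq_zero.1 (hloc.hasDerivAt_eq_zero (hasDerivAt_Jb_add_smul G hws hμ hh β u v))
  have hx := eq_intV_div_volV_of_orthogonal_Hsp hμ horth x
  have hint : intV μ (fun x => lapV G w μ u x + β * h x * Real.exp (u x) /
      intV μ (fun y => h y * Real.exp (u y))) = β := by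
    have hsplit : intV μ (fun x => lapV G w μ u x + β * h x * Real.exp (u x) /
          intV μ (fun y => h y * Real.exp (u y)))
        = intV μ (lapV G w μ u) + β * (intV μ (fun y => h y * Real.exp (u y)) /
          intV μ (fun y => h y * Real.exp (u y))) := by
      generalize hJ : intV μ (fun y => h y * Real.exp (u y)) = I
      nth_rewrite 2 [← hJ]
      unfold intV
      rw [Finset.sum_div, Finset.mul_sum, ← Finset.sum_add_distrib]
      exact Finset.sum_congr rfl fun x _ => by ring
    rw [hsplit, intV_lapV G hws hμ, div_self hI.ne', zero_add, mul_one]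
  rw [hint] at hx
  rw [neg_div]
  linarith
end

section
/- If α > λ₁(V), then for every real number β the functional J_{α,β}(u) = (1/2)∫_V (|∇u|² − α u²) dμ − β log ∫_V h e^u dμ satisfies inf_{u∈H} J_{α,β}(u) = −∞. -/
open Finset

variable {V : Type*}

theorem intV_smul_sq [Fintype V] (μ u : V → ℝ) (t : ℝ) :
    intV μ (fun x => (t • u) x ^ 2) = t ^ 2 * intV μ (fun x => u x ^ 2) := by
  simp only [intV, Pi.smul_apply, smul_eq_mul, Finset.mul_sum]
  exact Finset.sum_congr rfl fun x _ => by ring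

theorem gradSq_smul [Fintype V] (G : SimpleGraph V) [DecidableRel G.Adj]
    (w : V → V → ℝ) (μ u : V → ℝ) (t : ℝ) (x : V) :
    gradSq G w μ (t • u) x = t ^ 2 * gradSq G w μ u x := by
  simp only [gradSq, Pi.smul_apply, smul_eq_mul, Finset.mul_sum]
  refine Finset.sum_congr rfl fun y _ => ?_
  split_ifs <;> ring

theorem smul_mem_Hsp [Fintype V] {μ u : V → ℝ} (hu : u ∈ Hsp μ) (t : ℝ) : t • u ∈ Hsp μ := by
  simp only [Hsp, Set.mem_ofPred_eq, intV, Pi.smul_apply, smul_eq_mul] at hu ⊢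
  rw [← mul_zero t, ← hu, Finset.mul_sum]
  exact Finset.sum_congr rfl fun x _ => by ring

theorem exists_mem_Hsp_normalized [Fintype V] [Nontrivial V] {μ : V → ℝ} (hμ : ∀ x, 0 < μ x) :
    ∃ u ∈ Hsp μ, intV μ (fun x => u x ^ 2) = 1 := by
  classical
  obtain ⟨a, b, hab⟩ := exists_pair_ne V
  let v : V → ℝ := Pi.single a (μ a)⁻¹ - Pi.single b (μ b)⁻¹
  have hv : v ∈ Hsp μ := by
    simp [v, Hsp, intV, mul_sub, Finset.sum_sub_distrib, Pi.single_apply, (hμ _).ne']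
  have hpos : 0 < intV μ (fun x => v x ^ 2) := by
    refine Finset.sum_pos' (fun x _ => mul_nonneg (hμ x).le (sq_nonneg _)) ⟨a, mem_univ a, ?_⟩
    have := hμ a
    simp only [v, Pi.sub_apply, Pi.single_eq_same, Pi.single_eq_of_ne hab, sub_zero]
    positivity
  refine ⟨(√(intV μ (fun x => v x ^ 2)))⁻¹ • v, smul_mem_Hsp hv _, ?_⟩
  rw [intV_smul_sq, inv_pow, Real.sq_sqrt hpos.le, inv_mul_cancel₀ hpos.ne']

theorem Jab_smul [Fintype V] (G : SimpleGraph V) [DecidableRel G.Adj]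
    (w : V → V → ℝ) (μ h : V → ℝ) (α β : ℝ) (u : V → ℝ) (t : ℝ) :
    Jab G w μ h α β (t • u) =
      t ^ 2 / 2 * (intV μ (gradSq G w μ u) - α * intV μ (fun x => u x ^ 2))
        - β * Real.log (intV μ (fun x => h x * Real.exp ((t • u) x))) := by
  rw [Jab]
  congr 1
  simp only [gradSq_smul, intV, Pi.smul_apply, smul_eq_mul, Finset.mul_sum,
    ← Finset.sum_sub_distrib]
  exact Finset.sum_congr rfl fun x _ => by ring

/-- The logarithm of `∫ h e^u` differs from that of `∫ h` by at most the supremum of `|u|`. -/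
theorem abs_log_intV_exp_sub_le [Fintype V] [Nonempty V] {μ h u : V → ℝ} (hμ : ∀ x, 0 < μ x)
    (hh : ∀ x, 0 < h x) {M : ℝ} (hM : ∀ x, |u x| ≤ M) :
    |Real.log (intV μ (fun x => h x * Real.exp (u x))) - Real.log (intV μ h)| ≤ M := by
  have hC : 0 < intV μ h := Finset.sum_pos (fun x _ => mul_pos (hμ x) (hh x)) univ_nonempty
  have hS : 0 < intV μ (fun x => h x * Real.exp (u x)) :=
    Finset.sum_pos (fun x _ => mul_pos (hμ x) (mul_pos (hh x) (Real.exp_pos _))) univ_nonempty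
  rw [← Real.log_div hS.ne' hC.ne', abs_le, Real.le_log_iff_exp_le (div_pos hS hC),
    Real.log_le_iff_le_exp (div_pos hS hC), le_div_iff₀ hC, div_le_iff₀ hC]
  simp only [intV, Finset.mul_sum]
  constructor <;> refine Finset.sum_le_sum fun x _ => ?_ <;>
    rw [mul_comm (Real.exp _), mul_assoc] <;>
    have := hμ x <;> have := hh x <;> have := abs_le.1 (hM x) <;> gcongr <;> linarith

theorem stmt2 [Fintype V] [Nontrivial V] (G : SimpleGraph V) [DecidableRel G.Adj]
    (hG : G.Connected) (w : V → V → ℝ) (hws : ∀ x y, w x y = w y x)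
    (hwp : ∀ x y, G.Adj x y → 0 < w x y)
    (μ : V → ℝ) (hμ : ∀ x, 0 < μ x) (h : V → ℝ) (hh : ∀ x, 0 < h x) (α β : ℝ) (hα : lam1V G w μ < α) :
    (⨅ u ∈ Hsp μ, (Jab G w μ h α β u : EReal)) = ⊥ := by
  obtain ⟨_, ⟨u, ⟨huH, hu1⟩, rfl⟩, hlt⟩ := exists_lt_of_csInf_lt
    (Set.Nonempty.image _ (exists_mem_Hsp_normalized hμ)) hα
  simp only at hlt
  obtain ⟨M, hM⟩ : ∃ M, ∀ x, |u x| ≤ M :=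
    ⟨∑ x, |u x|, fun x => Finset.single_le_sum (fun y _ => abs_nonneg (u y)) (mem_univ x)⟩
  set c := (α - intV μ (gradSq G w μ u)) / 2 with hc
  have hc0 : 0 < c := by linarith
  set L := Real.log (intV μ h) with hL
  have bound : ∀ t : ℝ, 0 ≤ t →
      Jab G w μ h α β (t • u) ≤ -(t * (c * t - |β| * M)) - β * L := by
    intro t ht
    have hlog := abs_log_intV_exp_sub_le (u := t • u) (M := t * M) hμ hh fun x => by
      rw [Pi.smul_apply, smul_eq_mul, abs_mul, abs_of_nonneg ht]
      exact mul_le_mul_of_nonneg_left (hM x) ht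
    have hβ := mul_le_mul_of_nonneg_left hlog (abs_nonneg β)
    rw [← abs_mul] at hβ
    have := (abs_le.1 hβ).1
    rw [Jab_smul, hu1]
    rw [← hL] at this
    linear_combination this + t ^ 2 * hc
  have htends : Filter.Tendsto (fun t : ℝ => t * (c * t - |β| * M)) Filter.atTop Filter.atTop :=
    Filter.tendsto_id.atTop_mul_atTop₀
      (Filter.tendsto_atTop_add_const_right _ _ (Filter.tendsto_id.const_mul_atTop hc0))
  rw [EReal.eq_bot_iff_forall_lt]
  intro r
  obtain ⟨t, ht, ht0⟩ := ((htends.eventually_gt_atTop (-r - β * L)).and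
    (Filter.eventually_ge_atTop 0)).exists
  refine (iInf₂_le (t • u) (smul_mem_Hsp huH t)).trans_lt (EReal.coe_lt_coe_iff.2 ?_)
  linarith [bound t ht0]
end

section
/- For every β > 0, the functional J_{λ₁(V),β}(u) = (1/2)∫_V (|∇u|² − λ₁(V) u²) dμ − β log ∫_V h e^u dμ satisfies inf_{u∈H} J_{λ₁(V),β}(u) = −∞. -/
open Finset

variable {V : Type*}

lemma intV_const_mul [Fintype V] (μ g : V → ℝ) (c : ℝ) :
    intV μ (fun x => c * g x) = c * intV μ g := by
  simp only [intV, Finset.mul_sum]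
  exact Finset.sum_congr rfl fun x _ => by ring

lemma gradSq_const_mul [Fintype V] (G : SimpleGraph V) [DecidableRel G.Adj]
    (w : V → V → ℝ) (μ u : V → ℝ) (c : ℝ) :
    gradSq G w μ (fun y => c * u y) = fun x => c ^ 2 * gradSq G w μ u x := by
  funext x
  simp only [gradSq, Finset.mul_sum]
  refine Finset.sum_congr rfl fun y _ => ?_
  split_ifs <;> ring

lemma intV_sub_mul [Fintype V] (μ f g : V → ℝ) (c : ℝ) :
    intV μ (fun x => f x - c * g x) = intV μ f - c * intV μ g := by
  simp only [intV, Finset.mul_sum, ← Finset.sum_sub_distrib]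
  exact Finset.sum_congr rfl fun x _ => by ring

lemma continuous_intV_s3 [Fintype V] (μ : V → ℝ) {F : (V → ℝ) → V → ℝ}
    (hF : ∀ x, Continuous fun u => F u x) : Continuous fun u => intV μ (F u) :=
  continuous_finsetSum _ fun x _ => (hF x).const_mul (μ x)

lemma continuous_gradSq [Fintype V] (G : SimpleGraph V) [DecidableRel G.Adj]
    (w : V → V → ℝ) (μ : V → ℝ) (x : V) : Continuous fun u => gradSq G w μ u x := by
  refine (continuous_finsetSum _ fun y _ => ?_).const_mul _
  split_ifs <;> fun_prop

lemma isCompact_unitSphere_Hsp [Fintype V] {μ : V → ℝ} (hμ : ∀ x, 0 < μ x) :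
    IsCompact {u | u ∈ Hsp μ ∧ intV μ (fun x => u x ^ 2) = 1} := by
  refine (isCompact_univ_pi fun x => isCompact_Icc (a := -(1 + 1 / μ x))
    (b := 1 + 1 / μ x)).of_isClosed_subset ?_ ?_
  · refine IsClosed.inter (isClosed_eq ?_ continuous_const) (isClosed_eq ?_ continuous_const)
    · exact continuous_intV_s3 μ (F := fun u => u) fun x => continuous_apply x
    · exact continuous_intV_s3 μ (F := fun u x => u x ^ 2) fun x => by fun_prop
  · rintro u ⟨-, hu⟩ x -
    have hle : μ x * u x ^ 2 ≤ 1 := by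
      rw [← hu]
      exact Finset.single_le_sum (f := fun y => μ y * u y ^ 2)
        (fun y _ => mul_nonneg (hμ y).le (sq_nonneg _)) (Finset.mem_univ x)
    have hsq : u x ^ 2 ≤ 1 / μ x := by
      rw [le_div_iff₀ (hμ x)]
      linarith
    exact ⟨by nlinarith [sq_nonneg (u x + 1)], by nlinarith [sq_nonneg (u x - 1)]⟩

lemma nonempty_unitSphere_Hsp [Fintype V] [Nontrivial V] {μ : V → ℝ} (hμ : ∀ x, 0 < μ x) :
    {u | u ∈ Hsp μ ∧ intV μ (fun x => u x ^ 2) = 1}.Nonempty := by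
  classical
  obtain ⟨a, b, hab⟩ := exists_pair_ne V
  set f : V → ℝ := fun x => (if x = a then 1 / μ a else 0) - (if x = b then 1 / μ b else 0)
    with hf
  have hmean : intV μ f = 0 := by
    simp [intV, hf, mul_sub, Finset.sum_sub_distrib, (hμ a).ne', (hμ b).ne']
  have hpos : 0 < intV μ (fun x => f x ^ 2) := by
    refine Finset.sum_pos' (fun x _ => mul_nonneg (hμ x).le (sq_nonneg _))
      ⟨a, Finset.mem_univ a, mul_pos (hμ a) ?_⟩
    have : f a = 1 / μ a := by simp [hf, hab]
    simp only [this]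
    exact pow_pos (one_div_pos.mpr (hμ a)) 2
  refine ⟨fun x => (√(intV μ fun x => f x ^ 2))⁻¹ * f x, ?_, ?_⟩
  · change intV μ _ = 0
    rw [intV_const_mul, hmean, mul_zero]
  · simp only [mul_pow]
    rw [intV_const_mul, inv_pow, Real.sq_sqrt hpos.le, inv_mul_cancel₀ hpos.ne']

lemma exists_gradSq_eq_lam1V [Fintype V] [Nontrivial V] (G : SimpleGraph V)
    [DecidableRel G.Adj] (w : V → V → ℝ) {μ : V → ℝ} (hμ : ∀ x, 0 < μ x) :
    ∃ v ∈ Hsp μ, intV μ (fun x => v x ^ 2) = 1 ∧ intV μ (gradSq G w μ v) = lam1V G w μ := by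
  obtain ⟨v, ⟨hv, hv1⟩, hmin, -⟩ := (isCompact_unitSphere_Hsp hμ).exists_sInf_image_eq_and_le
    (nonempty_unitSphere_Hsp hμ)
    (continuous_intV_s3 μ (F := gradSq G w μ) (continuous_gradSq G w μ)).continuousOn
  exact ⟨v, hv, hv1, hmin.symm⟩

lemma exists_pos_of_mem_Hsp [Fintype V] {μ v : V → ℝ} (hμ : ∀ x, 0 < μ x)
    (hv : v ∈ Hsp μ) (hv0 : intV μ (fun x => v x ^ 2) ≠ 0) : ∃ x, 0 < v x := by
  by_contra! hle
  refine hv0 (Finset.sum_eq_zero fun x hx => ?_)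
  have hz : μ x * v x = 0 := (Finset.sum_eq_zero_iff_of_nonpos fun y _ =>
    mul_nonpos_of_nonneg_of_nonpos (hμ y).le (hle y)).mp hv x hx
  simp only [sq, ← mul_assoc, hz, zero_mul]

theorem stmt3 [Fintype V] [Nontrivial V] (G : SimpleGraph V) [DecidableRel G.Adj]
    (hG : G.Connected) (w : V → V → ℝ) (hws : ∀ x y, w x y = w y x)
    (hwp : ∀ x y, G.Adj x y → 0 < w x y)
    (μ : V → ℝ) (hμ : ∀ x, 0 < μ x) (h : V → ℝ) (hh : ∀ x, 0 < h x) (β : ℝ) (hβ : 0 < β) :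
    (⨅ u ∈ Hsp μ, (Jab G w μ h (lam1V G w μ) β u : EReal)) = ⊥ := by
  obtain ⟨v, hv, hv1, hlam⟩ := exists_gradSq_eq_lam1V G w hμ
  obtain ⟨a, ha⟩ := exists_pos_of_mem_Hsp hμ hv (by rw [hv1]; exact one_ne_zero)
  have hmem (t : ℝ) : (fun x => t * v x) ∈ Hsp μ := by
    change intV μ _ = 0
    rw [intV_const_mul, show intV μ v = 0 from hv, mul_zero]
  have hbound (t : ℝ) : Jab G w μ h (lam1V G w μ) β (fun x => t * v x)
      ≤ -(β * (Real.log (μ a * h a) + t * v a)) := by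
    have hquad : intV μ (fun x => gradSq G w μ (fun x => t * v x) x
        - lam1V G w μ * (t * v x) ^ 2) = 0 := by
      rw [intV_sub_mul]
      simp only [gradSq_const_mul, mul_pow]
      rw [intV_const_mul, intV_const_mul, hv1, hlam]
      ring
    have hpos : 0 < μ a * h a := mul_pos (hμ a) (hh a)
    have hlog : Real.log (μ a * h a) + t * v a
        ≤ Real.log (intV μ (fun x => h x * Real.exp (t * v x))) := by
      rw [← Real.log_exp (t * v a), ← Real.log_mul hpos.ne' (Real.exp_pos _).ne',
        mul_assoc]
      refine Real.log_le_log (mul_pos (hμ a) (mul_pos (hh a) (Real.exp_pos _))) ?_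
      exact Finset.single_le_sum (f := fun x => μ x * (h x * Real.exp (t * v x)))
        (fun x _ => (mul_pos (hμ x) (mul_pos (hh x) (Real.exp_pos _))).le) (Finset.mem_univ a)
    rw [Jab, hquad, mul_zero, zero_sub]
    exact neg_le_neg (mul_le_mul_of_nonneg_left hlog hβ.le)
  rw [EReal.eq_bot_iff_forall_lt]
  intro y
  set t : ℝ := ((1 - y) / β - Real.log (μ a * h a)) / v a with ht
  refine (iInf₂_le _ (hmem t)).trans_lt (EReal.coe_lt_coe_iff.mpr ((hbound t).trans_lt ?_))
  rw [ht, div_mul_cancel₀ _ ha.ne', add_sub_cancel, mul_div_cancel₀ _ hβ.ne']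
  linarith
end

section
/- For any θ ∈ ℝ there exists a constant C, depending only on θ and the graph G (and μ, w), such that for every v ∈ H with ∫_V |∇v|² dμ ≤ 1 one has ∫_V e^{θ v²} dμ ≤ C. -/
open Finset

variable {V : Type*}

theorem intV_gradSq_eq [Fintype V] (G : SimpleGraph V) [DecidableRel G.Adj]
    (w : V → V → ℝ) (μ : V → ℝ) (hμ : ∀ x, 0 < μ x) (v : V → ℝ) :
    intV μ (gradSq G w μ v) =
      (1 / 2) * ∑ x, ∑ y, if G.Adj x y then w x y * (v y - v x) ^ 2 else 0 := by
  unfold intV gradSq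
  rw [Finset.mul_sum]
  refine Finset.sum_congr rfl fun x _ => ?_
  have := (hμ x).ne'
  field_simp

theorem weight_mul_sq_sub_le [Fintype V] (G : SimpleGraph V) [DecidableRel G.Adj]
    (w : V → V → ℝ) (hwp : ∀ x y, G.Adj x y → 0 < w x y)
    (μ : V → ℝ) (hμ : ∀ x, 0 < μ x) (v : V → ℝ) {a b : V} (hab : G.Adj a b) :
    w a b * (v b - v a) ^ 2 ≤ 2 * intV μ (gradSq G w μ v) := by
  have hnn : ∀ x y, 0 ≤ if G.Adj x y then w x y * (v y - v x) ^ 2 else 0 := by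
    intro x y
    split_ifs with h
    · exact mul_nonneg (hwp x y h).le (sq_nonneg _)
    · exact le_rfl
  have h₁ := Finset.single_le_sum (fun y _ => hnn a y) (Finset.mem_univ b)
  have h₂ := Finset.single_le_sum
    (fun x _ => Finset.sum_nonneg (s := Finset.univ) fun y _ => hnn x y) (Finset.mem_univ a)
  rw [if_pos hab] at h₁
  rw [intV_gradSq_eq G w μ hμ v]
  linarith

/-- On a connected graph, the oscillation between two vertices is uniformly bounded
over all functions of Dirichlet energy at most one. -/
theorem exists_abs_sub_le [Fintype V] (G : SimpleGraph V) [DecidableRel G.Adj]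
    (hG : G.Connected) (w : V → V → ℝ) (hwp : ∀ x y, G.Adj x y → 0 < w x y)
    (μ : V → ℝ) (hμ : ∀ x, 0 < μ x) (x y : V) :
    ∃ K : ℝ, ∀ v : V → ℝ, intV μ (gradSq G w μ v) ≤ 1 → |v x - v y| ≤ K := by
  obtain ⟨p⟩ := hG.preconnected x y
  induction p with
  | nil => exact ⟨0, fun v _ => by simp⟩
  | @cons a b c hab _ ih =>
    obtain ⟨K, hK⟩ := ih
    refine ⟨√(2 / w a b) + K, fun v hv => ?_⟩
    have h := weight_mul_sq_sub_le G w hwp μ hμ v hab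
    have hle : |v a - v b| ≤ √(2 / w a b) := by
      refine Real.abs_le_sqrt ?_
      rw [le_div_iff₀ (hwp a b hab)]
      nlinarith
    exact (abs_sub_le _ (v b) _).trans (add_le_add hle (hK v hv))

/-- Functions of zero mean and Dirichlet energy at most one are uniformly bounded
at each vertex. -/
theorem exists_abs_le [Fintype V] (G : SimpleGraph V) [DecidableRel G.Adj]
    (hG : G.Connected) (w : V → V → ℝ) (hwp : ∀ x y, G.Adj x y → 0 < w x y)
    (μ : V → ℝ) (hμ : ∀ x, 0 < μ x) (x : V) :
    ∃ D : ℝ, ∀ v ∈ Hsp μ, intV μ (gradSq G w μ v) ≤ 1 → |v x| ≤ D := by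
  choose K hK using exists_abs_sub_le G hG w hwp μ hμ x
  have hvol : 0 < volV μ := Finset.sum_pos (fun y _ => hμ y) ⟨x, Finset.mem_univ x⟩
  refine ⟨(∑ y, μ y * K y) / volV μ, fun v hv hE => ?_⟩
  have hmean : ∑ y, μ y * v y = 0 := hv
  have hsum : v x * volV μ = ∑ y, μ y * (v x - v y) := by
    simp only [mul_sub, Finset.sum_sub_distrib, hmean, ← Finset.sum_mul, volV]
    ring
  rw [le_div_iff₀ hvol]
  calc |v x| * volV μ = |∑ y, μ y * (v x - v y)| := by
        rw [← hsum, abs_mul, abs_of_pos hvol]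
    _ ≤ ∑ y, |μ y * (v x - v y)| := Finset.abs_sum_le_sum_abs _ _
    _ ≤ ∑ y, μ y * K y := Finset.sum_le_sum fun y _ => by
        rw [abs_mul, abs_of_pos (hμ y)]
        exact mul_le_mul_of_nonneg_left (hK y v hE) (hμ y).le

theorem stmt10 [Fintype V] (G : SimpleGraph V) [DecidableRel G.Adj]
    (hG : G.Connected) (w : V → V → ℝ) (hws : ∀ x y, w x y = w y x)
    (hwp : ∀ x y, G.Adj x y → 0 < w x y)
    (μ : V → ℝ) (hμ : ∀ x, 0 < μ x) (θ : ℝ) :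
    ∃ C : ℝ, ∀ v ∈ Hsp μ, intV μ (gradSq G w μ v) ≤ 1 →
      intV μ (fun x => Real.exp (θ * v x ^ 2)) ≤ C := by
  choose D hD using exists_abs_le G hG w hwp μ hμ
  refine ⟨intV μ fun x => Real.exp (|θ| * D x ^ 2), fun v hv hE => ?_⟩
  refine Finset.sum_le_sum fun x _ => mul_le_mul_of_nonneg_left ?_ (hμ x).le
  refine Real.exp_le_exp.mpr (mul_le_mul (le_abs_self θ) ?_ (sq_nonneg _) (abs_nonneg θ))
  exact sq_le_sq' (abs_le.mp (hD x v hv hE)).1 (abs_le.mp (hD x v hv hE)).2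
end
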